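/- Let x be a real number with either x ≤ -2 or -1/2 ≤ x < 0, and let m, n be distinct positive integers. Then Φ_m(x) ≠ Φ_n(x). -/

import Mathlib

open Polynomial
open ArithmeticFunction

/-- The product `∏_{d ∣ r} (1 - q ^ d) ^ μ(d)`. -/
noncomputable def moebiusProd (r : ℕ) (q : ℝ) : ℝ :=
  ∏ d ∈ r.divisors, (1 - q ^ d) ^ (moebius d)

theorem one_sub_geom_le_prod_Ico {q : ℝ} (h0 : 0 < q) (h1 : q < 1) (N M : ℕ) (hNM : N ≤ M) :
    1 - (q ^ N - q ^ M) / (1 - q) ≤ ∏ d ∈ Finset.Ico N M, (1 - q ^ d) := by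
  have hq : 0 < 1 - q := by linarith
  induction M, hNM using Nat.le_induction with
  | base => simp
  | succ M hM ih =>
    rw [Finset.prod_Ico_succ_top hM]
    have hle : ∏ d ∈ Finset.Ico N M, (1 - q ^ d) ≤ 1 :=
      Finset.prod_le_one (fun d _ => by linarith [pow_le_one₀ h0.le h1.le (n := d)])
        (fun d _ => by linarith [pow_pos h0 d])
    have hp := pow_pos h0 M
    have : (q ^ N - q ^ (M + 1)) / (1 - q) = (q ^ N - q ^ M) / (1 - q) + q ^ M := by
      field_simp; ring
    rw [this]
    nlinarith

theorem one_sub_le_zpow_one_sub {a : ℝ} (h0 : 0 < a) (h1 : a < 1) {e : ℤ} (he : e ≤ 1) :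
    1 - a ≤ (1 - a) ^ e := by
  simpa using zpow_le_zpow_right_of_le_one₀ (a := 1 - a) (by linarith) (by linarith) he

theorem one_le_zpow_one_sub {a : ℝ} (h0 : 0 < a) (h1 : a < 1) {e : ℤ} (he : e ≤ 0) :
    1 ≤ (1 - a) ^ e := by
  simpa using zpow_le_zpow_right_of_le_one₀ (a := 1 - a) (by linarith) (by linarith) he

/-- Lower bound for a product of powers of `1 - q ^ d` with exponents at most `1`, where
exponent `1` below `N` only occurs on `T`. -/
theorem lt_prod_zpow_one_sub_pow {q : ℝ} (h0 : 0 < q) (h1 : q < 1) (S T : Finset ℕ) (N : ℕ)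
    (e : ℕ → ℤ) (hS : ∀ d ∈ S, 0 < d) (hT : ∀ d ∈ T, 0 < d ∧ d < N) (he : ∀ d, e d ≤ 1)
    (hneg : ∀ d ∈ S, d < N → d ∉ T → e d ≤ 0) :
    (∏ d ∈ T, (1 - q ^ d)) * (1 - q ^ N / (1 - q)) < ∏ d ∈ S, (1 - q ^ d) ^ (e d) := by
  have hlt : ∀ d : ℕ, 0 < d → q ^ d < 1 := fun d hd => pow_lt_one₀ h0.le h1 hd.ne'
  set M := max N (S.sup id + 1) with hM
  have hMN : N ≤ M := le_max_left _ _
  have hSM : ∀ d ∈ S, d < M := fun d hd =>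
    lt_of_lt_of_le (Nat.lt_succ_of_le (Finset.le_sup (f := id) hd)) (le_max_right _ _)
  have hTpos : 0 < ∏ d ∈ T, (1 - q ^ d) :=
    Finset.prod_pos fun d hd => by linarith [hlt d (hT d hd).1]
  have hgeom : 1 - q ^ N / (1 - q) < ∏ d ∈ Finset.Ico N M, (1 - q ^ d) := by
    refine lt_of_lt_of_le ?_ (one_sub_geom_le_prod_Ico h0 h1 N M hMN)
    have : q ^ N - q ^ M < q ^ N := by linarith [pow_pos h0 M]
    have := div_lt_div_of_pos_right this (by linarith : 0 < 1 - q)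
    linarith
  have hdisj : Disjoint T (Finset.Ico N M) := by
    rw [Finset.disjoint_left]
    intro d hd hd'
    have := (hT d hd).2
    have := (Finset.mem_Ico.1 hd').1
    omega
  calc (∏ d ∈ T, (1 - q ^ d)) * (1 - q ^ N / (1 - q))
      < (∏ d ∈ T, (1 - q ^ d)) * ∏ d ∈ Finset.Ico N M, (1 - q ^ d) := by gcongr
    _ = ∏ d ∈ T ∪ Finset.Ico N M, (1 - q ^ d) := (Finset.prod_union hdisj).symm
    _ ≤ ∏ d ∈ S.filter (fun d => d ∈ T ∨ N ≤ d), (1 - q ^ d) := by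
        refine Finset.prod_le_prod_of_subset_of_le_one ?_ ?_ ?_
        · intro d hd
          simp only [Finset.mem_filter, Finset.mem_union, Finset.mem_Ico] at hd ⊢
          exact hd.2.imp id fun h => ⟨h, hSM d hd.1⟩
        · intro d _
          linarith [pow_le_one₀ h0.le h1.le (n := d)]
        · intro d _ _
          linarith [pow_pos h0 d]
    _ = ∏ d ∈ S, if d ∈ T ∨ N ≤ d then 1 - q ^ d else 1 := Finset.prod_filter _ _
    _ ≤ ∏ d ∈ S, (1 - q ^ d) ^ (e d) := by
        refine Finset.prod_le_prod ?_ ?_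
        · intro d hd
          split_ifs
          · linarith [hlt d (hS d hd)]
          · exact zero_le_one
        · intro d hd
          split_ifs with h
          · exact one_sub_le_zpow_one_sub (pow_pos h0 d) (hlt d (hS d hd)) (he d)
          · push Not at h
            exact one_le_zpow_one_sub (pow_pos h0 d) (hlt d (hS d hd)) (hneg d hd h.2 h.1)

/-- For `q ≤ 1 / 2` the factor of least index with nonzero exponent dominates. -/
theorem one_lt_prod_zpow_one_sub_pow {q : ℝ} (h0 : 0 < q) (h1 : q ≤ 1 / 2) (S : Finset ℕ)
    (e : ℕ → ℤ) (hS : ∀ d ∈ S, 0 < d) (he : ∀ d, e d ≤ 1) {k : ℕ} (hk : k ∈ S)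
    (hek : e k ≤ -1) (hneg : ∀ d ∈ S, d < k → e d ≤ 0) :
    1 < ∏ d ∈ S, (1 - q ^ d) ^ (e d) := by
  have hq1 : q < 1 := by linarith
  have hkpos := pow_pos h0 k
  have hklt : q ^ k < 1 := pow_lt_one₀ h0.le hq1 (hS k hk).ne'
  have htail := lt_prod_zpow_one_sub_pow h0 hq1 (S.erase k) ∅ (k + 1) e
    (fun d hd => hS d (Finset.mem_of_mem_erase hd)) (by simp) he (by
      intro d hd hdk _
      have := Finset.ne_of_mem_erase hd
      exact hneg d (Finset.mem_of_mem_erase hd) (by omega))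
  have hle : q ^ (k + 1) / (1 - q) ≤ q ^ k := by
    rw [div_le_iff₀ (by linarith), pow_succ]
    nlinarith
  rw [Finset.prod_empty, one_mul] at htail
  have hlead : (1 - q ^ k)⁻¹ ≤ (1 - q ^ k) ^ (e k) := by
    simpa using zpow_le_zpow_right_of_le_one₀ (a := 1 - q ^ k) (by linarith) (by linarith) hek
  have hpos : 0 < 1 - q ^ k := by linarith
  rw [← Finset.mul_prod_erase S _ hk]
  calc (1 : ℝ) = (1 - q ^ k)⁻¹ * (1 - q ^ k) := by field_simp
    _ < (1 - q ^ k)⁻¹ * ∏ d ∈ S.erase k, (1 - q ^ d) ^ (e d) := by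
        have := inv_pos.2 hpos
        gcongr
        linarith
    _ ≤ _ := by
        gcongr
        exact (by linarith : 0 ≤ 1 - q ^ (k + 1) / (1 - q)).trans htail.le

theorem moebius_le_one (d : ℕ) : moebius d ≤ 1 := (abs_le.1 abs_moebius_le_one).2

theorem neg_moebius_le_one (d : ℕ) : -moebius d ≤ 1 := by
  linarith [(abs_le.1 (abs_moebius_le_one (n := d))).1]

theorem moebiusProd_pos (r : ℕ) {q : ℝ} (h0 : 0 < q) (h1 : q < 1) : 0 < moebiusProd r q :=
  Finset.prod_pos fun d hd => zpow_pos (by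
    linarith [pow_lt_one₀ h0.le h1 (Nat.pos_of_mem_divisors hd).ne']) _

theorem moebiusProd_inv (r : ℕ) (q : ℝ) :
    (moebiusProd r q)⁻¹ = ∏ d ∈ r.divisors, (1 - q ^ d) ^ (-moebius d) := by
  simp [moebiusProd]

theorem moebiusProd_lt_one {r : ℕ} (hr : r ≠ 0) {q : ℝ} (h0 : 0 < q) (h1 : q ≤ 1 / 2) :
    moebiusProd r q < 1 := by
  rw [← one_lt_inv₀ (moebiusProd_pos r h0 (by linarith)), moebiusProd_inv]
  refine one_lt_prod_zpow_one_sub_pow h0 h1 _ _ (fun d hd => Nat.pos_of_mem_divisors hd)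
    neg_moebius_le_one (k := 1) (by simpa using hr) (by simp) ?_
  intro d hd hd1
  have := Nat.pos_of_mem_divisors hd
  omega

theorem moebiusProd_eq_mul_erase {r : ℕ} (hr : r ≠ 0) (q : ℝ) :
    moebiusProd r q = (1 - q) * ∏ d ∈ r.divisors.erase 1, (1 - q ^ d) ^ (moebius d) := by
  rw [moebiusProd, ← Finset.mul_prod_erase _ _ (Nat.one_mem_divisors.2 hr)]
  simp

theorem one_sub_lt_moebiusProd {r : ℕ} (hr : 2 ≤ r) {q : ℝ} (h0 : 0 < q) (h1 : q ≤ 1 / 2) :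
    1 - q < moebiusProd r q := by
  rw [moebiusProd_eq_mul_erase (by omega)]
  have hp : r.minFac.Prime := Nat.minFac_prime (by omega)
  refine lt_mul_of_one_lt_right (by linarith) ?_
  refine one_lt_prod_zpow_one_sub_pow h0 h1 _ _
    (fun d hd => Nat.pos_of_mem_divisors (Finset.mem_of_mem_erase hd)) moebius_le_one
    (k := r.minFac) ?_ (moebius_apply_prime hp).le ?_
  · simp only [Finset.mem_erase, Nat.mem_divisors]
    exact ⟨hp.one_lt.ne', r.minFac_dvd, by omega⟩
  · intro d hd hlt
    simp only [Finset.mem_erase, Nat.mem_divisors] at hd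
    have h2 : 2 ≤ d := by
      have := Nat.pos_of_dvd_of_pos hd.2.1 (by omega)
      omega
    exact absurd (Nat.minFac_le_of_dvd h2 hd.2.1) (by omega)

/-- Comparison through the least index dividing exactly one of `r` and `s`. -/
theorem moebiusProd_ne {r s : ℕ} (hr : Squarefree r) (hs : Squarefree s) (hrs : r ≠ s)
    {q : ℝ} (h0 : 0 < q) (h1 : q ≤ 1 / 2) : moebiusProd r q ≠ moebiusProd s q := by
  set U := r.divisors ∪ s.divisors with hU
  have hUpos : ∀ d ∈ U, 0 < d := fun d hd =>
    (Finset.mem_union.1 hd).elim Nat.pos_of_mem_divisors Nat.pos_of_mem_divisors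
  have hnz : ∀ d ∈ U, 1 - q ^ d ≠ 0 := fun d hd => by
    linarith [pow_lt_one₀ h0.le (by linarith : q < 1) (hUpos d hd).ne']
  have key : ∀ t, t.divisors ⊆ U →
      moebiusProd t q = ∏ d ∈ U, (1 - q ^ d) ^ (if d ∈ t.divisors then moebius d else 0) := by
    intro t ht
    rw [moebiusProd, ← Finset.prod_subset ht]
    · exact Finset.prod_congr rfl fun d hd => by rw [if_pos hd]
    · intro d _ hd
      rw [if_neg hd, zpow_zero]
  set e : ℕ → ℤ := fun d => (if d ∈ r.divisors then moebius d else 0) -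
    (if d ∈ s.divisors then moebius d else 0) with he
  have hratio : moebiusProd r q / moebiusProd s q = ∏ d ∈ U, (1 - q ^ d) ^ e d := by
    rw [key r Finset.subset_union_left, key s Finset.subset_union_right, ← Finset.prod_div_distrib]
    exact Finset.prod_congr rfl fun d hd => by rw [he, zpow_sub₀ (hnz d hd)]
  have habs : ∀ d, |e d| ≤ 1 := by
    intro d
    simp only [he]
    have := abs_moebius_le_one (n := d)
    split_ifs <;> simp [this]
  have hex : ∃ d, d ∈ U ∧ e d ≠ 0 := by
    rcases lt_or_gt_of_ne hrs with h | h
    · refine ⟨s, Finset.mem_union_right _ (Nat.mem_divisors_self s hs.ne_zero), ?_⟩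
      have h2 : s ∉ r.divisors := fun hd => absurd (Nat.divisor_le hd) (by omega)
      simpa only [he, h2, Nat.mem_divisors_self s hs.ne_zero, if_true, if_false, zero_sub] using
        neg_ne_zero.2 (moebius_ne_zero_iff_squarefree.2 hs)
    · refine ⟨r, Finset.mem_union_left _ (Nat.mem_divisors_self r hr.ne_zero), ?_⟩
      have h2 : r ∉ s.divisors := fun hd => absurd (Nat.divisor_le hd) (by omega)
      simpa only [he, h2, Nat.mem_divisors_self r hr.ne_zero, if_true, if_false, sub_zero] using
        moebius_ne_zero_iff_squarefree.2 hr
  classical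
  obtain ⟨hkU, hek⟩ := Nat.find_spec hex
  have hmin : ∀ d ∈ U, d < Nat.find hex → e d = 0 := fun d hd hlt => by
    by_contra hne
    exact Nat.find_min hex hlt ⟨hd, hne⟩
  intro heq
  have hone : ∏ d ∈ U, (1 - q ^ d) ^ e d = 1 := by
    rw [← hratio, heq, div_self (moebiusProd_pos s h0 (by linarith)).ne']
  rcases lt_or_gt_of_ne hek with h | h
  · exact (one_lt_prod_zpow_one_sub_pow h0 h1 U e hUpos (fun d => (abs_le.1 (habs d)).2) hkU
      (by omega) (fun d hd hlt => (hmin d hd hlt).le)).ne' hone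
  · refine (one_lt_prod_zpow_one_sub_pow h0 h1 U (fun d => -e d) hUpos
      (fun d => by linarith [(abs_le.1 (habs d)).1]) hkU (by omega)
      (fun d hd hlt => by simp [hmin d hd hlt])).ne' ?_
    simp [zpow_neg, hone]

theorem moebius_four : moebius 4 = 0 := by
  refine moebius_eq_zero_of_not_squarefree fun h => ?_
  have := h 2 ⟨1, rfl⟩
  simp at this

theorem moebius_six : moebius 6 = 1 := by
  have := isMultiplicative_moebius.map_mul_of_coprime (m := 2) (n := 3) (by norm_num)
  rw [moebius_apply_prime Nat.prime_two, moebius_apply_prime Nat.prime_three] at this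
  simpa using this

theorem moebiusProd_mul_lt {r : ℕ} (hr : r ≠ 0) {q : ℝ} (h0 : 0 < q) (h1 : q < 1)
    (T : Finset ℕ) (N : ℕ) (hT : ∀ d ∈ T, 0 < d ∧ d < N)
    (hneg : ∀ d, 1 < d → d < N → d ∉ T → 0 ≤ moebius d) :
    moebiusProd r q * ((∏ d ∈ T, (1 - q ^ d)) * (1 - q ^ N / (1 - q))) < 1 - q := by
  have hP := lt_prod_zpow_one_sub_pow h0 h1 (r.divisors.erase 1) T N (fun d => -moebius d)
    (fun d hd => Nat.pos_of_mem_divisors (Finset.mem_of_mem_erase hd)) hT neg_moebius_le_one (by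
      intro d hd hdN hdT
      have h1 := Finset.ne_of_mem_erase hd
      have h2 := Nat.pos_of_mem_divisors (Finset.mem_of_mem_erase hd)
      have := hneg d (by omega) hdN hdT
      omega)
  have hH := moebiusProd_pos r h0 h1
  have heq : moebiusProd r q * ∏ d ∈ r.divisors.erase 1, (1 - q ^ d) ^ (-moebius d) = 1 - q := by
    have hi := moebiusProd_inv r q
    rw [← Finset.mul_prod_erase _ _ (Nat.one_mem_divisors.2 hr)] at hi
    have h1q : (1 - q) ≠ 0 := by linarith
    simp only [pow_one, moebius_apply_one, zpow_neg, zpow_one] at hi ⊢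
    field_simp at hi
    simpa only [one_div] using hi.symm
  calc _ < _ := mul_lt_mul_of_pos_left hP hH
    _ = _ := heq

theorem lt_moebiusProd_of_two_dvd {s : ℕ} (hs : s ≠ 0) (h2 : 2 ∣ s) {q : ℝ} (h0 : 0 < q)
    (h1 : q < 1) : 1 - q ^ 6 / (1 - q) < (1 + q) * moebiusProd s q := by
  have h2mem : 2 ∈ s.divisors.erase 1 := by simp [hs, h2]
  have hP := lt_prod_zpow_one_sub_pow h0 h1 ((s.divisors.erase 1).erase 2) ∅ 6 (fun d => moebius d)
    (fun d hd => Nat.pos_of_mem_divisors (Finset.mem_of_mem_erase (Finset.mem_of_mem_erase hd)))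
    (by simp) moebius_le_one (by
      intro d hd hdN _
      have h1 := Finset.ne_of_mem_erase hd
      have h2 := Finset.ne_of_mem_erase (Finset.mem_of_mem_erase hd)
      have h3 := Nat.pos_of_mem_divisors (Finset.mem_of_mem_erase (Finset.mem_of_mem_erase hd))
      interval_cases d
      · exact absurd rfl h2
      · exact absurd rfl h1
      · simp [moebius_apply_prime Nat.prime_three]
      · simp [moebius_four]
      · simp [moebius_apply_prime Nat.prime_five])
  rw [Finset.prod_empty, one_mul] at hP
  rw [moebiusProd_eq_mul_erase hs, ← Finset.mul_prod_erase _ _ h2mem,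
    moebius_apply_prime Nat.prime_two, zpow_neg_one]
  have h3 : 1 - q ^ 2 ≠ 0 := by nlinarith
  have h4 : (1 + q) * ((1 - q) * ((1 - q ^ 2)⁻¹ *
      ∏ d ∈ (s.divisors.erase 1).erase 2, (1 - q ^ d) ^ moebius d)) =
      ∏ d ∈ (s.divisors.erase 1).erase 2, (1 - q ^ d) ^ moebius d := by
    field_simp
    ring
  rw [h4]
  exact hP

theorem div_one_sub_le_two_mul {q a : ℝ} (ha : 0 ≤ a) (h1 : q ≤ 1 / 2) :
    a / (1 - q) ≤ 2 * a := by
  rw [div_le_iff₀ (by linarith)]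
  nlinarith

theorem moebiusProd_lt_one_sub_half {r : ℕ} (hr : r ≠ 0) {q : ℝ} (h0 : 0 < q) (h1 : q ≤ 1 / 4) :
    moebiusProd r q < 1 - q / 2 := by
  have h := moebiusProd_mul_lt hr h0 (by linarith) ∅ 2 (by simp) (by intro d _ _; omega)
  rw [Finset.prod_empty, one_mul] at h
  have hd : q ^ 2 / (1 - q) ≤ 4 / 3 * q ^ 2 := by
    rw [div_le_iff₀ (by linarith)]
    nlinarith [sq_nonneg q]
  by_contra! hc
  have hB : 0 < 1 - 4 / 3 * q ^ 2 := by nlinarith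
  have : (1 - q / 2) * (1 - 4 / 3 * q ^ 2) ≤ moebiusProd r q * (1 - q ^ 2 / (1 - q)) := by
    apply mul_le_mul hc (by linarith) hB.le (moebiusProd_pos r h0 (by linarith)).le
  nlinarith [mul_pos h0 h0, mul_pos h0 (mul_pos h0 h0)]

theorem moebiusProd_lt_one_sub_cube {r : ℕ} (hr : r ≠ 0) {q : ℝ} (h0 : 0 < q) (h1 : q ≤ 1 / 2) :
    moebiusProd r q < 1 - q ^ 3 := by
  have h := moebiusProd_mul_lt hr h0 (by linarith) {2, 3} 5 (by simp) (by
    intro d _ _ hd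
    simp only [Finset.mem_insert, Finset.mem_singleton, not_or] at hd
    interval_cases d <;> simp_all [moebius_four])
  rw [Finset.prod_pair (by norm_num)] at h
  have hd := div_one_sub_le_two_mul (a := q ^ 5) (by positivity) h1
  by_contra! hc
  have q2 : q ^ 2 ≤ 1 / 4 := by nlinarith
  have q3 : q ^ 3 ≤ 1 / 8 := by nlinarith [pow_pos h0 2]
  have q4 : q ^ 4 ≤ 1 / 16 := by nlinarith [pow_pos h0 2]
  have q5 : 2 * q ^ 5 ≤ q ^ 4 := by nlinarith [pow_pos h0 4]
  have hA : 0 < (1 - q ^ 2) * (1 - q ^ 3) := mul_pos (by linarith) (by linarith)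
  have : (1 - q ^ 3) * ((1 - q ^ 2) * (1 - q ^ 3) * (1 - q ^ 4)) ≤
      moebiusProd r q * ((1 - q ^ 2) * (1 - q ^ 3) * (1 - q ^ 5 / (1 - q))) := by
    refine mul_le_mul hc ?_ ?_ (moebiusProd_pos r h0 (by linarith)).le
    · exact mul_le_mul_of_nonneg_left (by linarith) hA.le
    · exact mul_nonneg hA.le (by linarith)
  have h5 : (1 - q) * ((1 + q) * ((1 - q ^ 3) * (1 - q ^ 3) * (1 - q ^ 4))) < (1 - q) * 1 := by
    linarith
  have h6 := lt_of_mul_lt_mul_left h5 (by linarith)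
  have h7 : 1 - 2 * q ^ 3 - q ^ 4 ≤ (1 - q ^ 3) * (1 - q ^ 3) * (1 - q ^ 4) := by
    have := pow_pos h0 3
    have := pow_pos h0 4
    nlinarith [mul_nonneg (sq_nonneg (q ^ 3)) (by linarith : 0 ≤ 1 - q ^ 4),
      mul_pos (pow_pos h0 3) (pow_pos h0 4)]
  have h8 : (1 + q) * (1 - 2 * q ^ 3 - q ^ 4) < 1 := by nlinarith
  have h9 : 0 < q * (1 - 2 * q ^ 2 - 3 * q ^ 3 - q ^ 4) := mul_pos h0 (by linarith)
  nlinarith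

theorem one_add_sq_le_mul {q : ℝ} (h0 : 0 < q) (h1 : q ≤ 1 / 2) : 1 + q ^ 2 ≤
    (1 + q) * ((1 - q ^ 3) * ((1 - q ^ 5) * (1 - 2 * q ^ 7))) * (1 - 1 / 24 * q ^ 7) := by
  have p5 := pow_pos h0 5
  have p7 := pow_pos h0 7
  have q2 : q ^ 2 ≤ 1 / 4 := by nlinarith
  have q3 : q ^ 3 ≤ 1 / 8 := by nlinarith [pow_pos h0 2]
  have q4 : q ^ 4 ≤ 1 / 16 := by nlinarith [pow_pos h0 2]
  have q5 : q ^ 5 ≤ 1 / 32 := by nlinarith [pow_pos h0 4]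
  have q7 : q ^ 7 ≤ 1 / 4 * q ^ 5 := by nlinarith
  by_contra! e4
  have hB : 0 < (1 + q) * (1 - q ^ 3) := mul_pos (by linarith) (by linarith)
  have e5 : 1 - 73 / 48 * q ^ 5 ≤ (1 - q ^ 5) * (1 - 2 * q ^ 7) * (1 - 1 / 24 * q ^ 7) := by
    have u : 1 - 49 / 24 * q ^ 7 ≤ (1 - 2 * q ^ 7) * (1 - 1 / 24 * q ^ 7) := by nlinarith
    have v : (1 - q ^ 5) * (1 - 49 / 24 * q ^ 7) ≤
        (1 - q ^ 5) * ((1 - 2 * q ^ 7) * (1 - 1 / 24 * q ^ 7)) :=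
      mul_le_mul_of_nonneg_left u (by linarith)
    have w := mul_pos p5 p7
    nlinarith
  have e6 : (1 + q) * (1 - q ^ 3) * (1 - 73 / 48 * q ^ 5) < 1 + q ^ 2 := by
    refine lt_of_le_of_lt (mul_le_mul_of_nonneg_left e5 hB.le) ?_
    linarith
  have e7 : 1 - q - q ^ 2 - q ^ 3 < 73 / 48 * q ^ 4 * ((1 + q) * (1 - q ^ 3)) := by
    refine lt_of_mul_lt_mul_left (a := q) ?_ h0.le
    linarith
  obtain ⟨t, ht⟩ : ∃ t, t = 1 / 2 - q := ⟨_, rfl⟩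
  have ht0 : 0 ≤ t := by linarith
  have e8 : (1 + q) * (1 - q ^ 3) ≤ 21 / 16 + t / 4 := by
    obtain rfl : q = 1 / 2 - t := by linarith
    have ht' : t < 1 / 2 := by linarith
    nlinarith [mul_nonneg ht0 ht0, mul_nonneg ht0 (mul_nonneg ht0 ht0),
      mul_nonneg (mul_nonneg ht0 ht0) (by linarith : 0 ≤ 1 / 2 - t), sq_nonneg (t * t)]
  have e9 : 1 / 8 + 3 / 2 * t ≤ 1 - q - q ^ 2 - q ^ 3 := by
    nlinarith
  have e10 : 73 / 48 * q ^ 4 * ((1 + q) * (1 - q ^ 3)) ≤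
      73 / 48 * (1 / 16) * (21 / 16 + t / 4) := by
    gcongr
  linarith

theorem moebiusProd_lt_moebiusProd_sq {r s : ℕ} (hr : r ≠ 0) (hs : s ≠ 0) (h2 : 2 ∣ s) {q : ℝ}
    (h0 : 0 < q) (h1 : q ≤ 1 / 2) : moebiusProd r q < moebiusProd s (q ^ 2) := by
  have h := moebiusProd_mul_lt hr h0 (by linarith) {2, 3, 5} 7 (by simp) (by
    intro d _ _ hd
    simp only [Finset.mem_insert, Finset.mem_singleton, not_or] at hd
    interval_cases d <;> simp_all [moebius_four, moebius_six])
  rw [Finset.prod_insert (by simp), Finset.prod_pair (by norm_num)] at h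
  have q2 : q ^ 2 ≤ 1 / 4 := by nlinarith
  have h' := lt_moebiusProd_of_two_dvd hs h2 (q := q ^ 2) (by positivity) (by linarith)
  have hd := div_one_sub_le_two_mul (a := q ^ 7) (by positivity) h1
  have p5 := pow_pos h0 5
  have p7 := pow_pos h0 7
  have q3 : q ^ 3 ≤ 1 / 8 := by nlinarith [pow_pos h0 2]
  have q4 : q ^ 4 ≤ 1 / 16 := by nlinarith [pow_pos h0 2]
  have q5 : q ^ 5 ≤ 1 / 32 := by nlinarith [pow_pos h0 4]
  have q7 : q ^ 7 ≤ 1 / 4 * q ^ 5 := by nlinarith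
  have hd' : (q ^ 2) ^ 6 / (1 - q ^ 2) ≤ 1 / 24 * q ^ 7 := by
    rw [div_le_iff₀ (by linarith)]
    have : q ^ 12 ≤ 1 / 32 * q ^ 7 := by nlinarith
    nlinarith
  by_contra! hc
  set a := moebiusProd r q with ha
  have hapos : 0 < a := moebiusProd_pos r h0 (by linarith)
  have e1 : 1 - 1 / 24 * q ^ 7 < (1 + q ^ 2) * a := by nlinarith
  have hA : 0 < (1 - q ^ 2) * ((1 - q ^ 3) * (1 - q ^ 5)) :=
    mul_pos (by linarith) (mul_pos (by linarith) (by linarith))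
  have e2 : a * ((1 - q ^ 2) * ((1 - q ^ 3) * (1 - q ^ 5)) * (1 - 2 * q ^ 7)) < 1 - q := by
    refine lt_of_le_of_lt ?_ h
    exact mul_le_mul_of_nonneg_left (mul_le_mul_of_nonneg_left (by linarith) hA.le) hapos.le
  have e3 : a * ((1 + q) * ((1 - q ^ 3) * ((1 - q ^ 5) * (1 - 2 * q ^ 7)))) < 1 := by
    refine lt_of_mul_lt_mul_left (a := 1 - q) ?_ (by linarith)
    linarith
  have e4 : (1 + q) * ((1 - q ^ 3) * ((1 - q ^ 5) * (1 - 2 * q ^ 7))) * (1 - 1 / 24 * q ^ 7) <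
      1 + q ^ 2 := by
    have hC : 0 < (1 + q) * ((1 - q ^ 3) * ((1 - q ^ 5) * (1 - 2 * q ^ 7))) :=
      mul_pos (by linarith) (mul_pos (by linarith) (mul_pos (by linarith) (by linarith)))
    calc _ < (1 + q) * ((1 - q ^ 3) * ((1 - q ^ 5) * (1 - 2 * q ^ 7))) * ((1 + q ^ 2) * a) := by
          gcongr
      _ = (1 + q ^ 2) *
          (a * ((1 + q) * ((1 - q ^ 3) * ((1 - q ^ 5) * (1 - 2 * q ^ 7))))) := by ring
      _ < (1 + q ^ 2) * 1 := by gcongr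
      _ = _ := mul_one _
  exact (one_add_sq_le_mul h0 h1).not_gt e4

theorem moebiusProd_pow_lt {r s k l : ℕ} (hr : r ≠ 0) (hs : 2 ≤ s) (hk : 0 < k) (hkl : k < l)
    (h2 : 2 ∣ l → 2 ∣ s) {q : ℝ} (h0 : 0 < q) (h1 : q ≤ 1 / 2) :
    moebiusProd r (q ^ k) < moebiusProd s (q ^ l) := by
  have hl1 : q ^ l ≤ 1 / 2 := by
    simpa using (pow_le_pow_of_le_one h0.le (by linarith) (by omega : 1 ≤ l)).trans_eq (pow_one q)
      |>.trans h1
  have hlow := one_sub_lt_moebiusProd hs (pow_pos h0 l) hl1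
  rcases (by omega : k = 1 ∧ l = 2 ∨ k = 1 ∧ 3 ≤ l ∨ 2 ≤ k) with ⟨rfl, rfl⟩ | ⟨rfl, hl⟩ | hk2
  · simpa using moebiusProd_lt_moebiusProd_sq hr (by omega) (h2 dvd_rfl) h0 h1
  · have := pow_le_pow_of_le_one h0.le (by linarith) hl
    rw [pow_one]
    linarith [moebiusProd_lt_one_sub_cube hr h0 h1]
  · have hk4 : q ^ k ≤ 1 / 4 :=
      (pow_le_pow_of_le_one h0.le (by linarith) hk2).trans (by nlinarith)
    have hle : q ^ l ≤ q ^ k / 2 := by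
      refine (pow_le_pow_of_le_one h0.le (by linarith) (Nat.succ_le_of_lt hkl)).trans ?_
      rw [pow_succ]
      nlinarith [pow_pos h0 k]
    linarith [moebiusProd_lt_one_sub_half hr (pow_pos h0 k) hk4]

theorem moebiusProd_pow_injective {r s k l : ℕ} (hr : Squarefree r) (hs : Squarefree s)
    (hk : 0 < k) (hl : 0 < l) (hkr : ∀ p, p.Prime → p ∣ k → p ∣ r)
    (hls : ∀ p, p.Prime → p ∣ l → p ∣ s) {q : ℝ} (h0 : 0 < q) (h1 : q ≤ 1 / 2)
    (h : moebiusProd r (q ^ k) = moebiusProd s (q ^ l)) : k = l ∧ r = s := by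
  have two_le : ∀ {s k l : ℕ}, Squarefree s → 0 < k → k < l →
      (∀ p, p.Prime → p ∣ l → p ∣ s) → 2 ≤ s := fun {s k l} hs hk hkl hls => by
    have hp := Nat.minFac_prime (by omega : l ≠ 1)
    exact hp.two_le.trans (Nat.le_of_dvd hs.ne_zero.bot_lt (hls _ hp (Nat.minFac_dvd l)))
  rcases lt_trichotomy k l with hkl | rfl | hkl
  · exact absurd h (moebiusProd_pow_lt hr.ne_zero (two_le hs hk hkl hls) hk hkl
      (hls 2 Nat.prime_two) h0 h1).ne
  · refine ⟨rfl, by_contra fun hne => moebiusProd_ne hr hs hne (pow_pos h0 k) ?_ h⟩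
    exact (pow_le_of_le_one h0.le (by linarith) hk.ne').trans h1
  · exact absurd h (moebiusProd_pow_lt hs.ne_zero (two_le hr hl hkl hkr) hl hkl
      (hkr 2 Nat.prime_two) h0 h1).ne'

/-- The product `∏_{a * b = n} (1 - q ^ b) ^ μ(a)`. -/
noncomputable def cyclotomicProd (n : ℕ) (q : ℝ) : ℝ :=
  ∏ x ∈ n.divisorsAntidiagonal, (1 - q ^ x.2) ^ (moebius x.1)

theorem cyclotomicProd_mul {k r : ℕ} (hk : 0 < k) (hr : Squarefree r)
    (h : ∀ a, Squarefree a → a ∣ k * r → a ∣ r) (q : ℝ) :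
    cyclotomicProd (k * r) q = (moebiusProd r (q ^ k)) ^ (moebius r) := by
  have hr0 := hr.ne_zero
  rw [cyclotomicProd,
    Nat.prod_divisorsAntidiagonal (f := fun a b => (1 - q ^ b) ^ (moebius a)),
    ← Finset.prod_subset (Nat.divisors_subset_of_dvd (by positivity) (Dvd.intro_left k rfl)),
    ← Nat.prod_div_divisors, moebiusProd, ← Finset.prod_zpow]
  · refine Finset.prod_congr rfl fun d hd => ?_
    obtain ⟨c, rfl⟩ := Nat.dvd_of_mem_divisors hd
    have hd0 := Nat.pos_of_mem_divisors hd
    have hc0 : 0 < c := Nat.pos_of_ne_zero fun hc => hr0 (by simp [hc])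
    have e1 : d * c / d = c := Nat.mul_div_cancel_left c hd0
    have e2 : k * (d * c) / c = k * d := by
      rw [← mul_assoc, Nat.mul_div_cancel _ hc0]
    have hcop : d.Coprime c := Nat.coprime_of_squarefree_mul hr
    have hdsq : Squarefree d := hr.squarefree_of_dvd (Dvd.intro _ rfl)
    have e3 : moebius d * moebius (d * c) = moebius c := by
      rw [isMultiplicative_moebius.map_mul_of_coprime hcop, ← mul_assoc, ← sq,
        moebius_sq_eq_one_of_squarefree hdsq, one_mul]
    rw [e1, e2, ← zpow_mul, e3, pow_mul]
  · intro a ha har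
    rw [moebius_eq_zero_of_not_squarefree, zpow_zero]
    exact fun hsq => har (Nat.mem_divisors.2 ⟨h a hsq (Nat.dvd_of_mem_divisors ha), hr0⟩)

theorem exists_mul_squarefree {n : ℕ} (hn : n ≠ 0) : ∃ k r : ℕ, n = k * r ∧ 0 < k ∧
    Squarefree r ∧ ∀ a, Squarefree a → a ∣ n → a ∣ r := by
  obtain ⟨k, hk⟩ := UniqueFactorizationMonoid.radical_dvd_self (a := n)
  refine ⟨k, UniqueFactorizationMonoid.radical n, by rw [mul_comm]; exact hk,
    Nat.pos_of_ne_zero fun h => hn (by rw [hk, h, mul_zero]),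
    UniqueFactorizationMonoid.squarefree_radical, fun a ha han => ?_⟩
  exact (ha.dvd_pow_iff_dvd hn).1
    (han.trans (Nat.dvd_radical_pow_self hn))

theorem cyclotomicProd_injective {m n : ℕ} (hm : m ≠ 0) (hn : n ≠ 0) {q : ℝ} (h0 : 0 < q)
    (h1 : q ≤ 1 / 2) (h : cyclotomicProd m q = cyclotomicProd n q) : m = n := by
  obtain ⟨k, r, rfl, hk, hr, hkr⟩ := exists_mul_squarefree hm
  obtain ⟨l, s, rfl, hl, hs, hls⟩ := exists_mul_squarefree hn
  rw [cyclotomicProd_mul hk hr hkr, cyclotomicProd_mul hl hs hls] at h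
  have hq : ∀ j, 0 < j → q ^ j ≤ 1 / 2 := fun j hj =>
    (pow_le_of_le_one h0.le (by linarith) hj.ne').trans h1
  have a0 := moebiusProd_pos r (pow_pos h0 k) (by linarith [hq k hk])
  have a1 := moebiusProd_lt_one hr.ne_zero (pow_pos h0 k) (hq k hk)
  have b0 := moebiusProd_pos s (pow_pos h0 l) (by linarith [hq l hl])
  have b1 := moebiusProd_lt_one hs.ne_zero (pow_pos h0 l) (hq l hl)
  have a2 := one_lt_inv₀ a0 |>.2 a1
  have b2 := one_lt_inv₀ b0 |>.2 b1
  have heq : moebiusProd r (q ^ k) = moebiusProd s (q ^ l) := by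
    rcases (moebius_ne_zero_iff_eq_or.1 (moebius_ne_zero_iff_squarefree.2 hr)) with hμ | hμ <;>
    rcases (moebius_ne_zero_iff_eq_or.1 (moebius_ne_zero_iff_squarefree.2 hs)) with hν | hν <;>
    simp only [hμ, hν, zpow_one, zpow_neg_one] at h
    · exact h
    · linarith
    · linarith
    · exact inv_injective h
  obtain ⟨rfl, rfl⟩ := moebiusProd_pow_injective hr hs hk hl
    (fun p hp hpk => hkr p hp.prime.squarefree (hpk.mul_right r))
    (fun p hp hpl => hls p hp.prime.squarefree (hpl.mul_right s)) h0 h1 heq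
  rfl

theorem cyclotomicProd_mem_Ioo {n : ℕ} (hn : 2 ≤ n) {q : ℝ} (h0 : 0 < q) (h1 : q ≤ 1 / 2) :
    1 / 2 < cyclotomicProd n q ∧ cyclotomicProd n q < 2 := by
  obtain ⟨k, r, rfl, hk, hr, hkr⟩ := exists_mul_squarefree (by omega : n ≠ 0)
  have hr2 : 2 ≤ r := by
    have hp := Nat.minFac_prime (by omega : k * r ≠ 1)
    exact hp.two_le.trans (Nat.le_of_dvd hr.ne_zero.bot_lt
      (hkr _ hp.prime.squarefree (Nat.minFac_dvd _)))
  rw [cyclotomicProd_mul hk hr hkr]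
  have hq : q ^ k ≤ 1 / 2 := (pow_le_of_le_one h0.le (by linarith) hk.ne').trans h1
  have a1 := moebiusProd_lt_one hr.ne_zero (pow_pos h0 k) hq
  have a2 : 1 / 2 < moebiusProd r (q ^ k) := by
    linarith [one_sub_lt_moebiusProd hr2 (pow_pos h0 k) hq]
  rcases (moebius_ne_zero_iff_eq_or.1 (moebius_ne_zero_iff_squarefree.2 hr)) with hμ | hμ <;>
    simp only [hμ, zpow_one, zpow_neg_one]
  · exact ⟨a2, by linarith⟩
  · have a3 := (one_lt_inv₀ (by linarith)).2 a1
    refine ⟨by linarith, inv_lt_of_inv_lt₀ (by norm_num) (by linarith)⟩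

theorem eq_cyclotomicProd_of_prod_divisors {f : ℕ → ℝ} {q : ℝ} (h0 : 0 < q) (h1 : q < 1)
    (hf : ∀ n > 0, ∏ i ∈ n.divisors, f i = 1 - q ^ n) {n : ℕ} (hn : 0 < n) :
    f n = cyclotomicProd n q := by
  have hne : ∀ n : ℕ, 0 < n → 1 - q ^ n ≠ 0 := fun n hn => by
    linarith [pow_lt_one₀ h0.le h1 hn.ne']
  have hfne : ∀ n : ℕ, 0 < n → f n ≠ 0 := fun n hn hfn =>
    hne n hn ((hf n hn).symm.trans
      (Finset.prod_eq_zero (Nat.mem_divisors_self n hn.ne') hfn))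
  exact ((prod_eq_iff_prod_pow_moebius_eq_of_nonzero hfne hne).1 hf n hn).symm

theorem prod_eval_cyclotomic {n : ℕ} (hn : 0 < n) (x : ℝ) :
    ∏ i ∈ n.divisors, (cyclotomic i ℝ).eval x = x ^ n - 1 := by
  rw [← eval_prod, prod_cyclotomic_eq_X_pow_sub_one hn]
  simp

theorem abs_eval_cyclotomic {n : ℕ} (hn : 0 < n) {q : ℝ} (h0 : 0 < q) (h1 : q < 1) :
    |(cyclotomic n ℝ).eval q| = cyclotomicProd n q := by
  refine eq_cyclotomicProd_of_prod_divisors (f := fun n => |(cyclotomic n ℝ).eval q|)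
    h0 h1 (fun n hn => ?_) hn
  rw [← Finset.abs_prod, prod_eval_cyclotomic hn, abs_sub_comm, abs_of_pos]
  linarith [pow_lt_one₀ h0.le h1 hn.ne']

theorem abs_eval_cyclotomic_inv {n : ℕ} (hn : 0 < n) {q : ℝ} (h0 : 0 < q) (h1 : q < 1) :
    q ^ n.totient * |(cyclotomic n ℝ).eval q⁻¹| = cyclotomicProd n q := by
  refine eq_cyclotomicProd_of_prod_divisors
    (f := fun n => q ^ n.totient * |(cyclotomic n ℝ).eval q⁻¹|) h0 h1 (fun n hn => ?_) hn
  have hlt := pow_lt_one₀ h0.le h1 hn.ne'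
  have hpos := pow_pos h0 n
  rw [Finset.prod_mul_distrib, Finset.prod_pow_eq_pow_sum, Nat.sum_totient, ← Finset.abs_prod,
    prod_eval_cyclotomic hn, inv_pow, abs_of_pos (by linarith [(one_lt_inv₀ hpos).2 hlt])]
  field_simp

theorem abs_eval_neg_cyclotomic_of_odd {n : ℕ} (hn : Odd n) {x : ℝ} (hx : |x| ≠ 1) :
    |(cyclotomic n ℝ).eval (-x)| = |(cyclotomic (2 * n) ℝ).eval x| := by
  have hodd : ∀ d ∈ n.divisors, Odd d := fun d hd => hn.of_dvd_nat (Nat.dvd_of_mem_divisors hd)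
  induction n using Nat.strong_induction_on with
  | _ n ih =>
  have hn0 : n ≠ 0 := fun h => by simp [h] at hn
  have hexp : ∀ d, Odd d → (cyclotomic d ℝ).eval (x ^ 2) =
      (cyclotomic (2 * d) ℝ).eval x * (cyclotomic d ℝ).eval x := fun d hd => by
    have := congrArg (eval x) (cyclotomic_expand_eq_cyclotomic_mul Nat.prime_two
      (fun h => (Nat.not_even_iff_odd.2 hd) (even_iff_two_dvd.2 h)) ℝ (n := d))
    rwa [expand_eval, eval_mul, mul_comm d 2] at this
  have hxn : |x| ^ n ≠ 1 := fun h => hx ((pow_eq_one_iff_of_nonneg (abs_nonneg x) hn0).1 h)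
  have h1 : x ^ n - 1 ≠ 0 := fun h => hxn (by rw [← abs_pow, sub_eq_zero.1 h, abs_one])
  have h2 : x ^ n + 1 ≠ 0 := fun h => hxn (by
    rw [← abs_pow, eq_neg_of_add_eq_zero_left h, abs_neg, abs_one])
  have hA : ∏ d ∈ n.divisors, |(cyclotomic (2 * d) ℝ).eval x| = |x ^ n + 1| := by
    have h3 : (∏ d ∈ n.divisors, (cyclotomic (2 * d) ℝ).eval x) * (x ^ n - 1) =
        (x ^ n + 1) * (x ^ n - 1) := by
      rw [← prod_eval_cyclotomic hn0.bot_lt x, ← Finset.prod_mul_distrib,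
        ← Finset.prod_congr rfl fun d hd => hexp d (hodd d hd),
        prod_eval_cyclotomic hn0.bot_lt, prod_eval_cyclotomic hn0.bot_lt]
      ring
    rw [← Finset.abs_prod, mul_right_cancel₀ h1 h3]
  have hB : ∏ d ∈ n.divisors, |(cyclotomic d ℝ).eval (-x)| = |x ^ n + 1| := by
    rw [← Finset.abs_prod, prod_eval_cyclotomic hn0.bot_lt, hn.neg_pow, ← abs_neg]
    congr 1
    ring
  have hself := Nat.mem_divisors_self n hn0
  have hpos := abs_pos.2 h2
  rw [← Finset.mul_prod_erase _ _ hself] at hA hB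
  have hE : ∏ d ∈ n.divisors.erase n, |(cyclotomic d ℝ).eval (-x)| =
      ∏ d ∈ n.divisors.erase n, |(cyclotomic (2 * d) ℝ).eval x| := by
    refine Finset.prod_congr rfl fun d hd => ?_
    have hd' := Finset.mem_of_mem_erase hd
    exact ih d ((Nat.divisor_le hd').lt_of_ne (Finset.ne_of_mem_erase hd)) (hodd d hd')
      fun c hc => hodd c (Nat.divisors_subset_of_dvd hn0 (Nat.dvd_of_mem_divisors hd') hc)
  rw [hE] at hB
  refine mul_right_cancel₀ (fun h0 => ?_) (hB.trans hA.symm)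
  rw [h0, mul_zero] at hB
  exact hpos.ne hB

/-- The involution on indices realizing `x ↦ -x` on cyclotomic polynomials up to sign. -/
def negIndex (n : ℕ) : ℕ :=
  if n % 2 = 1 then 2 * n else if n % 4 = 2 then n / 2 else n

theorem negIndex_injective : Function.Injective negIndex := by
  intro m n h
  unfold negIndex at h
  split_ifs at h <;> omega

theorem negIndex_pos {n : ℕ} (hn : 0 < n) : 0 < negIndex n := by
  unfold negIndex
  split_ifs <;> omega

theorem two_lt_negIndex {n : ℕ} (hn : 2 < n) : 2 < negIndex n := by
  unfold negIndex
  split_ifs <;> omega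

theorem abs_eval_neg_cyclotomic (n : ℕ) {x : ℝ} (hx : |x| ≠ 1) :
    |(cyclotomic n ℝ).eval (-x)| = |(cyclotomic (negIndex n) ℝ).eval x| := by
  unfold negIndex
  split_ifs with h1 h2
  · exact abs_eval_neg_cyclotomic_of_odd (Nat.odd_iff.2 h1) hx
  · have := abs_eval_neg_cyclotomic_of_odd (n := n / 2) (x := -x) (Nat.odd_iff.2 (by omega))
      (by rwa [abs_neg])
    rw [neg_neg, show 2 * (n / 2) = n by omega] at this
    exact this.symm
  · have h := cyclotomic_expand_eq_cyclotomic (n := n / 2) Nat.prime_two (by omega) ℝ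
    rw [show n / 2 * 2 = n by omega] at h
    rw [← h, expand_eval, expand_eval, neg_sq]

theorem eval_cyclotomic_ne_of_le_neg_two {x : ℝ} (hx : x ≤ -2) {m n : ℕ} (hm : 0 < m)
    (hmn : m < n) : (cyclotomic m ℝ).eval x ≠ (cyclotomic n ℝ).eval x := by
  rcases (by omega : m = 1 ∧ n = 2 ∨ m ≤ 2 ∧ 2 < n ∨ 2 < m) with ⟨rfl, rfl⟩ | ⟨hm2, hn⟩ | hm2
  · simp only [cyclotomic_one, cyclotomic_two, eval_sub, eval_add, eval_X, eval_one]
    intro h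
    linarith
  · have := cyclotomic_pos hn x
    rcases (by omega : m = 1 ∨ m = 2) with rfl | rfl <;>
    simp only [cyclotomic_one, cyclotomic_two, eval_sub, eval_add, eval_X, eval_one] <;>
    intro h <;> linarith
  intro h
  obtain ⟨q, hq⟩ : ∃ q, q = (-x)⁻¹ := ⟨_, rfl⟩
  have hxq : x = -q⁻¹ := by rw [hq, inv_inv, neg_neg]
  have h0 : 0 < q := hq ▸ inv_pos.2 (by linarith)
  have h1 : q ≤ 1 / 2 := by
    rw [hq, one_div]
    exact inv_anti₀ (by norm_num) (by linarith)
  have hq1 : |q⁻¹| ≠ 1 := by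
    have : 2 ≤ q⁻¹ := by linarith
    rw [abs_of_pos (by linarith)]
    linarith
  set M := negIndex m with hM
  set N := negIndex n with hN
  have hM2 : 2 < M := two_lt_negIndex hm2
  have hN2 : 2 < N := two_lt_negIndex (by omega)
  have habs : |(cyclotomic M ℝ).eval q⁻¹| = |(cyclotomic N ℝ).eval q⁻¹| := by
    rw [← abs_eval_neg_cyclotomic m hq1, ← abs_eval_neg_cyclotomic n hq1, ← hxq, h]
  have key : ∀ {M N : ℕ}, 2 < M → 2 < N →
      |(cyclotomic M ℝ).eval q⁻¹| = |(cyclotomic N ℝ).eval q⁻¹| →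
      ¬ M.totient < N.totient := by
    intro M N hM2 hN2 habs hlt
    obtain ⟨a, ha⟩ := Nat.totient_even hM2
    obtain ⟨b, hb⟩ := Nat.totient_even hN2
    obtain ⟨j, hj⟩ : ∃ j, N.totient = M.totient + 2 + j := ⟨N.totient - (M.totient + 2), by omega⟩
    have eM := abs_eval_cyclotomic_inv (by omega : 0 < M) h0 (by linarith)
    have eN := abs_eval_cyclotomic_inv (by omega : 0 < N) h0 (by linarith)
    have bM := (cyclotomicProd_mem_Ioo (by omega : 2 ≤ M) h0 h1).2
    have bN := (cyclotomicProd_mem_Ioo (by omega : 2 ≤ N) h0 h1).1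
    have e : cyclotomicProd N q = q ^ 2 * q ^ j * cyclotomicProd M q := by
      rw [← eM, ← eN, habs, hj]
      ring
    have hj1 : q ^ j ≤ 1 := pow_le_one₀ h0.le (by linarith)
    have hj0 := pow_pos h0 j
    have hq2 : q ^ 2 * q ^ j ≤ 1 / 4 := by nlinarith
    have hq0 : 0 < q ^ 2 * q ^ j := by positivity
    nlinarith
  have htot : M.totient = N.totient :=
    le_antisymm (not_lt.1 (key hN2 hM2 habs.symm)) (not_lt.1 (key hM2 hN2 habs))
  have hMN : M = N := by
    refine cyclotomicProd_injective (by omega) (by omega) h0 h1 ?_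
    rw [← abs_eval_cyclotomic_inv (by omega) h0 (by linarith),
      ← abs_eval_cyclotomic_inv (by omega) h0 (by linarith), htot, habs]
  exact hmn.ne (negIndex_injective hMN)

theorem eval_cyclotomic_ne_of_neg_half_le {x : ℝ} (hx : -(1 / 2) ≤ x) (hx0 : x < 0) {m n : ℕ}
    (hm : 0 < m) (hn : 0 < n) (hmn : m ≠ n) :
    (cyclotomic m ℝ).eval x ≠ (cyclotomic n ℝ).eval x := by
  intro h
  have hq1 : |-x| ≠ 1 := by
    rw [abs_of_pos (by linarith)]
    linarith
  have habs : cyclotomicProd (negIndex m) (-x) = cyclotomicProd (negIndex n) (-x) := by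
    rw [← abs_eval_cyclotomic (negIndex_pos hm) (by linarith) (by linarith),
      ← abs_eval_cyclotomic (negIndex_pos hn) (by linarith) (by linarith),
      ← abs_eval_neg_cyclotomic m hq1, ← abs_eval_neg_cyclotomic n hq1, neg_neg, h]
  exact hmn (negIndex_injective (cyclotomicProd_injective (negIndex_pos hm).ne'
    (negIndex_pos hn).ne' (by linarith) (by linarith) habs))

theorem cyclotomic_ne_neg_real (x : ℝ) (hx : x ≤ -2 ∨ (-(1 / 2) ≤ x ∧ x < 0))
    (m n : ℕ) (hm : 0 < m) (hn : 0 < n) (hmn : m ≠ n) :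
    (Polynomial.cyclotomic m ℝ).eval x ≠ (Polynomial.cyclotomic n ℝ).eval x := by
  rcases hx with hx | ⟨hx, hx0⟩
  · rcases lt_or_gt_of_ne hmn with h | h
    · exact eval_cyclotomic_ne_of_le_neg_two hx hm h
    · exact (eval_cyclotomic_ne_of_le_neg_two hx hn h).symm
  · exact eval_cyclotomic_ne_of_neg_half_le hx hx0 hm hn hmn
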